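/- arXiv:1705.04611 — 2 statements merged into one kernel-verified Lean document; each statement's English description precedes it below -/
import Mathlib

section
/- Let n > 2 and let k < 0 be an integer. Set c := ∑_{m=0}^{|k|−1} (|k|−m)·ν(m, n−2), let S_1 := {0} ⊆ Fin n, and for 1 ≤ l ≤ n−1 let T_l := {0, 1, …, n−l} ⊆ Fin n. Then the quantum line bundle L_k is isomorphic, as a left B_n-module, to the direct sum of c copies of B_n·∂(Q_{S_1}) together with, for each l = 1, …, n−1, ν(|k|−1, l) copies of B_n·∂(Q_{T_l}). -/
noncomputable section

/-- `H n` is the Hilbert space `ℓ²(ℕ^n)`. -/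
abbrev Hn (n : ℕ) : Type := lp (fun _ : (Fin n → ℕ) => ℂ) 2

/-- the standard basis vector `δ_z`. -/
def delta {n : ℕ} (z : Fin n → ℕ) : Hn n := lp.single 2 z 1

/-- `T` is the `i`-th coordinate shift: `T δ_z = δ_{z + e_i}`. -/
def IsShift {n : ℕ} (i : Fin n) (T : Hn n →L[ℂ] Hn n) : Prop :=
  ∀ z : Fin n → ℕ, T (delta z) = delta (Function.update z i (z i + 1))

/-- The Toeplitz algebra `T_n`: the smallest norm-closed star-subalgebra of `B(H_n)`
containing the coordinate shifts. -/
def Toeplitz (n : ℕ) : StarSubalgebra ℂ (Hn n →L[ℂ] Hn n) :=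
  (StarAlgebra.adjoin ℂ {T : Hn n →L[ℂ] Hn n | ∃ i : Fin n, IsShift i T}).topologicalClosure
/-- Padding a matrix by zeros into an `N × N` matrix along an embedding `f`. -/
def padMat {R : Type*} [Semiring R] {ι : Type*} [Fintype ι] {N : ℕ}
    (f : ι ↪ Fin N) (P : Matrix ι ι R) : Matrix (Fin N) (Fin N) R :=
  fun i j => ∑ a : ι, ∑ b : ι, if f a = i ∧ f b = j then P a b else 0

/-- Equivalence of (idempotent) matrices over a ring `R`: after enlarging by zero diagonal blocks
to a common size `N`, they are conjugate by an invertible `N × N` matrix. -/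
def IdemEquiv {R : Type*} [Ring R] {ι κ : Type*} [Fintype ι] [Fintype κ]
    (P : Matrix ι ι R) (Q : Matrix κ κ R) : Prop :=
  ∃ (N : ℕ) (f : ι ↪ Fin N) (g : κ ↪ Fin N) (U : (Matrix (Fin N) (Fin N) R)ˣ),
    U.val * padMat f P * (U⁻¹).val = padMat g Q


/-- The two-sided ideal `J_n` of compact operators in the Toeplitz algebra `T_n`. -/
def compactIdeal (n : ℕ) : TwoSidedIdeal ↥(Toeplitz n) :=
  TwoSidedIdeal.mk'
    {a : ↥(Toeplitz n) | IsCompactOperator ⇑(a : Hn n →L[ℂ] Hn n)}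
    (by
      show IsCompactOperator ⇑(((0 : ↥(Toeplitz n)) : Hn n →L[ℂ] Hn n))
      simp only [ZeroMemClass.coe_zero, ContinuousLinearMap.coe_zero]
      exact isCompactOperator_zero)
    (fun {x y} hx hy => by
      show IsCompactOperator ⇑(((x + y : ↥(Toeplitz n)) : Hn n →L[ℂ] Hn n))
      simp only [AddMemClass.coe_add, ContinuousLinearMap.coe_add']
      exact hx.add hy)
    (fun {x} hx => by
      show IsCompactOperator ⇑(((-x : ↥(Toeplitz n)) : Hn n →L[ℂ] Hn n))
      simp only [NegMemClass.coe_neg, ContinuousLinearMap.coe_neg']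
      exact hx.neg)
    (fun {x y} hy => by
      show IsCompactOperator ⇑(((x * y : ↥(Toeplitz n)) : Hn n →L[ℂ] Hn n))
      have := hy.clm_comp (x : Hn n →L[ℂ] Hn n)
      simpa [Function.comp] using this)
    (fun {x y} hx => by
      show IsCompactOperator ⇑(((x * y : ↥(Toeplitz n)) : Hn n →L[ℂ] Hn n))
      have := hx.comp_clm (y : Hn n →L[ℂ] Hn n)
      simpa [Function.comp] using this)

/-- The quotient ring `A_n = T_n / J_n`, isomorphic to `C(S_H^{2n-1})`. -/
def QuantumSphere (n : ℕ) : Type := (compactIdeal n).ringCon.Quotient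

instance (n : ℕ) : Ring (QuantumSphere n) :=
  inferInstanceAs (Ring (compactIdeal n).ringCon.Quotient)


/-- The quotient map `∂ : T_n → A_n`. -/
def toSphere (n : ℕ) : ↥(Toeplitz n) →+* QuantumSphere n := (compactIdeal n).ringCon.mk'

open scoped Classical in
/-- `Q` is the orthogonal projection onto the closed span of `{δ_z : z_i = 0 for all i ∉ S}`,
characterized by its action on the orthonormal basis. -/
def IsQProj {n : ℕ} (S : Finset (Fin n)) (Q : Hn n →L[ℂ] Hn n) : Prop :=
  ∀ z : Fin n → ℕ, Q (delta z) = if ∀ i ∉ S, z i = 0 then delta z else 0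

/-- The block-diagonal projection `⊞_{S ∈ A} ⊞^{l(S)} q_S` over a ring `R`. -/
def antichainMatR {R : Type*} [Ring R] {n : ℕ}
    (A : Finset (Finset (Fin n))) (l : Finset (Fin n) → ℕ) (q : Finset (Fin n) → R) :
    Matrix ((S : {x // x ∈ A}) × Fin (l S.1)) ((S : {x // x ∈ A}) × Fin (l S.1)) R :=
  Matrix.diagonal fun p => q p.1.1

/-- The fixed-point subring `B_n` of `A_n` under a family of ring automorphisms. -/
def fixedSubring {n : ℕ} (α : Circle → (QuantumSphere n →+* QuantumSphere n)) :
    Subring (QuantumSphere n) where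
  carrier := {a | ∀ ζ, α ζ a = a}
  mul_mem' := fun ha hb ζ => by rw [map_mul, ha ζ, hb ζ]
  one_mem' := fun ζ => map_one (α ζ)
  add_mem' := fun ha hb ζ => by rw [map_add, ha ζ, hb ζ]
  zero_mem' := fun ζ => map_zero (α ζ)
  neg_mem' := fun ha ζ => by rw [map_neg, ha ζ]

/-- The block-diagonal projection `⊞_{S ∈ A} ⊞^{l(S)} q_S` with entries in the
fixed-point subring `B_n`. -/
def antichainMatFix {n : ℕ} (α : Circle → (QuantumSphere n →+* QuantumSphere n))
    (A : Finset (Finset (Fin n))) (l : Finset (Fin n) → ℕ)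
    (q : Finset (Fin n) → QuantumSphere n) (hq : ∀ S ∈ A, q S ∈ fixedSubring α) :
    Matrix ((S : {x // x ∈ A}) × Fin (l S.1)) ((S : {x // x ∈ A}) × Fin (l S.1))
      ↥(fixedSubring α) :=
  Matrix.diagonal fun p => ⟨q p.1.1, hq p.1.1 p.1.2⟩

/-- The combinatorial numbers `ν(m, l)`: `ν(m, 1) = 1` and
`ν(m, l) = ∑_{s=0}^{m} ν(s, l-1)` for `l ≥ 2`. (The value at `l = 0` is junk.) -/
def nu : ℕ → ℕ → ℕ
  | _, 0 => 0
  | _, 1 => 1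
  | m, l + 2 => ∑ s ∈ Finset.range (m + 1), nu s (l + 1)

/-- The subset `B_n · q = {b q : b ∈ B_n}` of `A_n`. -/
def BnMul {n : ℕ} (α : Circle → (QuantumSphere n →+* QuantumSphere n))
    (q : QuantumSphere n) : Set (QuantumSphere n) :=
  {y | ∃ b ∈ fixedSubring α, y = b * q}

/-- The degree-`k` quantum line bundle `L_k ⊆ A_n`, the set of elements `a` with
`α_ζ(a) = ζ^k a` for all `ζ ∈ 𝕋`. -/
def lineBundle {n : ℕ} (α : Circle → (QuantumSphere n →+* QuantumSphere n))
    (k : ℤ) : Set (QuantumSphere n) :=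
  {a | ∀ ζ : Circle,
    α ζ a = toSphere n
      ⟨algebraMap ℂ (Hn n →L[ℂ] Hn n) ((ζ : ℂ) ^ k),
        (Toeplitz n).algebraMap_mem _⟩ * a}

lemma inner_delta_right {n : ℕ} (x : Hn n) (z : Fin n → ℕ) :
    inner ℂ (delta z) x = x z := by
  simp [delta, lp.inner_single_left]

lemma delta_apply {n : ℕ} (z w : Fin n → ℕ) : delta z w = if w = z then 1 else 0 := by
  by_cases h : w = z
  · subst h
    simp [delta]
  · simp [delta, h]

lemma inner_delta_delta {n : ℕ} (z w : Fin n → ℕ) :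
    inner ℂ (delta z) (delta w) = if z = w then (1 : ℂ) else 0 := by
  rw [inner_delta_right, delta_apply]

lemma orthonormal_delta (n : ℕ) : Orthonormal ℂ (delta : (Fin n → ℕ) → Hn n) :=
  orthonormal_iff_ite.2 inner_delta_delta

/-- Vectors of `ℓ²(ℕ^n)` are determined by their coefficients. -/
lemma ext_inner_delta {n : ℕ} {x y : Hn n}
    (h : ∀ w, inner ℂ (delta w) x = inner ℂ (delta w) y) : x = y := by
  refine lp.ext (funext fun w => ?_)
  simpa only [inner_delta_right] using h w

/-- Bounded operators on `ℓ²(ℕ^n)` are determined by their values on the standard basis. -/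
lemma clm_ext_delta {n : ℕ} {A B : Hn n →L[ℂ] Hn n} (h : ∀ z, A (delta z) = B (delta z)) :
    A = B := by
  refine lp.ext_continuousLinearMap (ENNReal.ofNat_ne_top (n := nat_lit 2)) fun z => ?_
  refine ContinuousLinearMap.ext_ring ?_
  simpa [delta] using h z

lemma inner_star_apply {n : ℕ} (A : Hn n →L[ℂ] Hn n) (x y : Hn n) :
    inner ℂ x (star A y) = inner ℂ (A x) y := by
  rw [ContinuousLinearMap.star_eq_adjoint, ContinuousLinearMap.adjoint_inner_right]

/-- An injection of `ℕ^n` into itself induces an isometry of `ℓ²(ℕ^n)`. -/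
lemma exists_clm_of_injective {n : ℕ} (φ : (Fin n → ℕ) → (Fin n → ℕ))
    (hφ : Function.Injective φ) :
    ∃ A : Hn n →L[ℂ] Hn n, ∀ z, A (delta z) = delta (φ z) := by
  have h := ((orthonormal_delta n).comp φ hφ).orthogonalFamily
  refine ⟨h.linearIsometry.toContinuousLinearMap, fun z => ?_⟩
  simp [delta]

lemma exists_isShift {n : ℕ} (i : Fin n) : ∃ A : Hn n →L[ℂ] Hn n, IsShift i A := by
  refine exists_clm_of_injective _ fun z w h => funext fun j => ?_
  have := congrFun h j
  by_cases hj : j = i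
  · subst hj
    simpa using this
  · simpa [hj] using this

/-- The Toeplitz algebra contains the translation by every vector of `ℕ^n`. -/
lemma exists_translation {n : ℕ} (e : Fin n → ℕ) :
    ∃ A ∈ Toeplitz n, ∀ z, A (delta z) = delta (z + e) := by
  let M : AddSubmonoid (Fin n → ℕ) :=
    { carrier := {e | ∃ A ∈ Toeplitz n, ∀ z, A (delta z) = delta (z + e)}
      zero_mem' := ⟨1, one_mem _, fun z => by simp⟩
      add_mem' := by
        rintro a b ⟨A, hA, hA'⟩ ⟨B, hB, hB'⟩
        refine ⟨A * B, mul_mem hA hB, fun z => ?_⟩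
        rw [mul_apply_eq_comp, hB', hA', add_assoc, add_comm b] }
  have hsingle : ∀ i : Fin n, Pi.single i 1 ∈ M := fun i => by
    obtain ⟨A, hA⟩ := exists_isShift i
    refine ⟨A, ?_, fun z => ?_⟩
    · exact (StarAlgebra.adjoin ℂ _).le_topologicalClosure
        (StarAlgebra.subset_adjoin ℂ _ ⟨i, hA⟩)
    · rw [hA z]
      congr 1
      ext j
      by_cases hj : j = i
      · subst hj
        simp
      · simp [hj]
  have he : e ∈ M := by
    rw [← Finset.univ_sum_single e]
    refine sum_mem fun i _ => ?_
    have : Pi.single i (e i) = e i • (Pi.single i 1 : Fin n → ℕ) := by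
      rw [← Pi.single_smul]
      simp
    rw [this]
    exact nsmul_mem (hsingle i) _
  exact he

/-- An operator vanishing on all but finitely many basis vectors is compact. -/
lemma isCompactOperator_of_finite_support {n : ℕ} (A : Hn n →L[ℂ] Hn n)
    (s : Finset (Fin n → ℕ)) (h : ∀ z ∉ s, A (delta z) = 0) : IsCompactOperator A := by
  have key : A = ∑ z ∈ s,
      (ContinuousLinearMap.toSpanSingleton ℂ (A (delta z))).comp (innerSL ℂ (delta z)) := by
    refine clm_ext_delta fun w => ?_
    simp only [sum_apply, ContinuousLinearMap.comp_apply,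
      innerSL_apply_apply, inner_delta_delta, ContinuousLinearMap.toSpanSingleton_apply, ite_smul,
      one_smul, zero_smul, Finset.sum_ite_eq']
    split_ifs with hw
    · rfl
    · exact h w hw
  rw [key]
  clear key h
  induction s using Finset.induction_on with
  | empty => simpa using isCompactOperator_zero
  | insert a s ha ih =>
    rw [Finset.sum_insert ha]
    refine IsCompactOperator.add ?_ ih
    exact ((isCompactOperator_id (E := ℂ)).comp_clm (innerSL ℂ (delta a))).clm_comp
      (ContinuousLinearMap.toSpanSingleton ℂ (A (delta a)))

lemma toSphere_eq_iff {n : ℕ} (a b : ↥(Toeplitz n)) :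
    toSphere n a = toSphere n b ↔
      IsCompactOperator ⇑((a : Hn n →L[ℂ] Hn n) - (b : Hn n →L[ℂ] Hn n)) := by
  rw [toSphere]
  refine (RingCon.eq _).trans ?_
  rw [TwoSidedIdeal.rel_iff, compactIdeal, TwoSidedIdeal.mem_mk']
  rfl

lemma toSphere_surjective (n : ℕ) : Function.Surjective (toSphere n) :=
  RingCon.mk'_surjective _

/-- The image of a complex scalar in the quotient `A_n`. -/
def sphereScalar (n : ℕ) : ℂ →+* QuantumSphere n :=
  (toSphere n).comp (algebraMap ℂ ↥(Toeplitz n))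

lemma sphereScalar_commute {n : ℕ} (c : ℂ) (a : QuantumSphere n) :
    sphereScalar n c * a = a * sphereScalar n c := by
  obtain ⟨a, rfl⟩ := toSphere_surjective n a
  rw [sphereScalar, RingHom.comp_apply, ← map_mul, ← map_mul, Algebra.commutes]

lemma mem_lineBundle {n : ℕ} {α : Circle → (QuantumSphere n →+* QuantumSphere n)} {k : ℤ}
    {a : QuantumSphere n} :
    a ∈ lineBundle α k ↔ ∀ ζ : Circle, α ζ a = sphereScalar n ((ζ : ℂ) ^ k) * a := Iff.rfl

lemma lineBundle_zero {n : ℕ} {α : Circle → (QuantumSphere n →+* QuantumSphere n)}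
    {a : QuantumSphere n} : a ∈ lineBundle α 0 ↔ a ∈ fixedSubring α := by
  simp only [mem_lineBundle, zpow_zero, map_one, one_mul]
  rfl

lemma lineBundle_mul {n : ℕ} {α : Circle → (QuantumSphere n →+* QuantumSphere n)} {j k : ℤ}
    {a b : QuantumSphere n} (ha : a ∈ lineBundle α j) (hb : b ∈ lineBundle α k) :
    a * b ∈ lineBundle α (j + k) := by
  rw [mem_lineBundle] at *
  intro ζ
  rw [map_mul, ha, hb, zpow_add₀ ζ.coe_ne_zero, map_mul, mul_assoc, ← mul_assoc a,
    ← sphereScalar_commute]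
  simp only [mul_assoc]

lemma lineBundle_sum {n : ℕ} {α : Circle → (QuantumSphere n →+* QuantumSphere n)} {k : ℤ}
    {ι : Type*} (s : Finset ι) {a : ι → QuantumSphere n} (ha : ∀ i ∈ s, a i ∈ lineBundle α k) :
    ∑ i ∈ s, a i ∈ lineBundle α k := by
  rw [mem_lineBundle]
  intro ζ
  rw [map_sum, Finset.mul_sum]
  exact Finset.sum_congr rfl fun i hi => ha i hi ζ

/-- A finite family `v` in `L_{-k}` with a dual family `u` in `L_k` splits `L_k` as the direct sum
of the modules `B_n q_i`, where `q_i = u_i v_i`. -/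
lemma exists_bijOn_of_dual_families {n : ℕ}
    (α : Circle → (QuantumSphere n →+* QuantumSphere n)) (k : ℤ)
    {ι : Type*} [Fintype ι] (q u v : ι → QuantumSphere n)
    (hu : ∀ i, u i ∈ lineBundle α k) (hv : ∀ i, v i ∈ lineBundle α (-k))
    (hvq : ∀ i, v i * q i = v i) (huv : ∀ i, u i * v i = q i)
    (huv' : ∀ i j, i ≠ j → u i * v j = 0) (hsum : ∑ i, v i * u i = 1) :
    ∃ F : QuantumSphere n → (ι → QuantumSphere n),
      Set.BijOn F (lineBundle α k) {g | ∀ i, g i ∈ BnMul α (q i)} ∧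
      (∀ x ∈ lineBundle α k, ∀ y ∈ lineBundle α k, F (x + y) = F x + F y) ∧
      (∀ b ∈ fixedSubring α, ∀ x ∈ lineBundle α k, F (b * x) = fun i => b * F x i) := by
  have hqq : ∀ i, q i * q i = q i := fun i => by
    nth_rewrite 1 [← huv i]
    rw [mul_assoc, hvq, huv]
  have hq : ∀ i, q i ∈ fixedSubring α := fun i => by
    rw [← lineBundle_zero, ← huv i, ← add_neg_cancel k]
    exact lineBundle_mul (hu i) (hv i)
  refine ⟨fun x i => x * v i, ⟨?_, ?_, ?_⟩, ?_, ?_⟩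
  · intro x hx i
    refine ⟨x * v i, ?_, by rw [mul_assoc, hvq]⟩
    rw [← lineBundle_zero, ← add_neg_cancel k]
    exact lineBundle_mul hx (hv i)
  · intro x _ y _ hxy
    have h : ∀ x : QuantumSphere n, x = ∑ i, x * v i * u i := fun x => by
      simp only [mul_assoc]
      rw [← Finset.mul_sum, hsum, mul_one]
    rw [h x, h y]
    exact Finset.sum_congr rfl fun i _ => congrArg (· * u i) (congrFun hxy i)
  · intro g hg
    refine ⟨∑ i, g i * u i, lineBundle_sum _ fun i _ => ?_, funext fun j => ?_⟩
    · obtain ⟨b, hb, hgb⟩ := hg i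
      rw [hgb, ← zero_add k]
      exact lineBundle_mul (lineBundle_zero.2 (mul_mem hb (hq i))) (hu i)
    · obtain ⟨b, hb, hgb⟩ := hg j
      simp only [Finset.sum_mul, mul_assoc]
      rw [Finset.sum_eq_single j (fun i _ hij => by rw [huv' i j hij, mul_zero])
        (fun h => absurd (Finset.mem_univ j) h), huv, hgb, mul_assoc, hqq]
  · intro x _ y _
    funext i
    exact add_mul x y (v i)
  · intro b _ x _
    funext i
    exact mul_assoc b x (v i)

/-- The translate of `{z : z_i = 0 for all i ∉ S}` by `e`. -/
def orthantTranslate {n : ℕ} (S : Finset (Fin n)) (e : Fin n → ℕ) : Set (Fin n → ℕ) :=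
  {z | e ≤ z ∧ ∀ i ∉ S, z i = e i}

lemma add_mem_orthantTranslate {n : ℕ} {S : Finset (Fin n)} {e z : Fin n → ℕ}
    (h : ∀ i ∉ S, z i = 0) : z + e ∈ orthantTranslate S e :=
  ⟨le_add_self, fun i hi => by simp [h i hi]⟩

open scoped Classical in
lemma translation_mul_proj_apply {n : ℕ} {S : Finset (Fin n)} {e : Fin n → ℕ}
    {A Q : Hn n →L[ℂ] Hn n} (hA : ∀ z, A (delta z) = delta (z + e)) (hQ : IsQProj S Q)
    (z : Fin n → ℕ) :
    (A * Q) (delta z) = if ∀ i ∉ S, z i = 0 then delta (z + e) else 0 := by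
  rw [mul_apply_eq_comp, hQ z]
  split_ifs
  · exact hA z
  · simp

open scoped Classical in
lemma star_translation_mul_proj_apply {n : ℕ} {S : Finset (Fin n)} {e : Fin n → ℕ}
    {A Q : Hn n →L[ℂ] Hn n} (hA : ∀ z, A (delta z) = delta (z + e)) (hQ : IsQProj S Q)
    (z : Fin n → ℕ) :
    star (A * Q) (delta z) = if z ∈ orthantTranslate S e then delta (z - e) else 0 := by
  refine ext_inner_delta fun w => ?_
  rw [inner_star_apply, translation_mul_proj_apply hA hQ]
  by_cases hz : z ∈ orthantTranslate S e
  · rw [if_pos hz, inner_delta_delta]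
    by_cases hw : w = z - e
    · subst hw
      have : ∀ i ∉ S, (z - e) i = 0 := fun i hi => by simp [hz.2 i hi]
      rw [if_pos this, if_pos rfl, inner_delta_delta, tsub_add_cancel_of_le hz.1, if_pos rfl]
    · rw [if_neg hw]
      split_ifs
      · rw [inner_delta_delta, if_neg]
        rintro rfl
        exact hw (add_tsub_cancel_right w e).symm
      · simp
  · rw [if_neg hz, inner_zero_right]
    split_ifs with hw
    · rw [inner_delta_delta, if_neg]
      rintro rfl
      exact hz (add_mem_orthantTranslate hw)
    · simp

/-- A partition of `{z : κ ≤ |z|}` into translates of coordinate orthants by vectors of length `κ`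
splits the line bundle of degree `-κ`. -/
lemma exists_bijOn_of_partition {n : ℕ} (κ : ℕ)
    (Q : Finset (Fin n) → (Hn n →L[ℂ] Hn n))
    (hQ : ∀ S, IsQProj S (Q S)) (hmem : ∀ S, Q S ∈ Toeplitz n)
    (V : Circle → (Hn n →L[ℂ] Hn n))
    (hV : ∀ (ζ : Circle) (z : Fin n → ℕ),
      V ζ (delta z) = ((ζ : ℂ) ^ (∑ i, z i)) • delta z)
    (hconj : ∀ (ζ : Circle) (T : Hn n →L[ℂ] Hn n), T ∈ Toeplitz n →
      V ζ * T * star (V ζ) ∈ Toeplitz n)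
    (α : Circle → (QuantumSphere n →+* QuantumSphere n))
    (hα : ∀ (ζ : Circle) (T : Hn n →L[ℂ] Hn n) (hT : T ∈ Toeplitz n),
      α ζ (toSphere n ⟨T, hT⟩) = toSphere n ⟨V ζ * T * star (V ζ), hconj ζ T hT⟩)
    {ι : Type*} [Fintype ι] (S : ι → Finset (Fin n)) (e : ι → Fin n → ℕ)
    (he : ∀ i, ∑ j, e i j = κ)
    (hpart : ∀ z : Fin n → ℕ, κ ≤ ∑ j, z j → ∃! i, z ∈ orthantTranslate (S i) (e i)) :
    ∃ F : QuantumSphere n → (ι → QuantumSphere n),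
      Set.BijOn F (lineBundle α (-κ))
        {g | ∀ i, g i ∈ BnMul α (toSphere n ⟨Q (S i), hmem (S i)⟩)} ∧
      (∀ x ∈ lineBundle α (-κ), ∀ y ∈ lineBundle α (-κ), F (x + y) = F x + F y) ∧
      (∀ b ∈ fixedSubring α, ∀ x ∈ lineBundle α (-κ), F (b * x) = fun i => b * F x i) := by
  classical
  choose A hA hAd using fun i => exists_translation (e i)
  set v : ι → (Hn n →L[ℂ] Hn n) := fun i => A i * Q (S i) with hvdef
  have hv : ∀ i, v i ∈ Toeplitz n := fun i => mul_mem (hA i) (hmem _)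
  have hu : ∀ i, star (v i) ∈ Toeplitz n := fun i => star_mem (hv i)
  have hvd := fun i => translation_mul_proj_apply (hAd i) (hQ (S i))
  have hud := fun i => star_translation_mul_proj_apply (hAd i) (hQ (S i))
  have hle : ∀ i z, z ∈ orthantTranslate (S i) (e i) → κ ≤ ∑ j, z j := fun i z hz => by
    rw [← he i]
    exact Finset.sum_le_sum fun j _ => hz.1 j
  have hVstar : ∀ ζ, V ζ * star (V ζ) = 1 := fun ζ => by
    have hstar : ∀ z, star (V ζ) (delta z) =
        (starRingEnd ℂ) ((ζ : ℂ) ^ (∑ i, z i)) • delta z := fun z => by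
      refine ext_inner_delta fun w => ?_
      rw [inner_star_apply, hV, inner_smul_left, inner_smul_right, inner_delta_delta]
      split_ifs with h
      · rw [h]
      · simp
    refine clm_ext_delta fun z => ?_
    rw [mul_apply_eq_comp, hstar, map_smul, hV, smul_smul, RCLike.conj_mul,
      norm_pow, Circle.norm_coe]
    simp
  have hgrade : ∀ ζ i, V ζ * v i * star (V ζ) =
      algebraMap ℂ (Hn n →L[ℂ] Hn n) ((ζ : ℂ) ^ κ) * v i := fun ζ i => by
    have : V ζ * v i = algebraMap ℂ (Hn n →L[ℂ] Hn n) ((ζ : ℂ) ^ κ) * v i * V ζ := by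
      refine clm_ext_delta fun z => ?_
      rw [← Algebra.smul_def]
      simp only [mul_apply_eq_comp (V ζ), mul_apply_eq_comp _ (V ζ),
        smul_apply, hV, map_smul, hvdef, hvd]
      split_ifs
      · rw [hV, smul_smul]
        simp only [Pi.add_apply, Finset.sum_add_distrib, he, pow_add]
      · simp
    rw [this, mul_assoc, hVstar, mul_one]
  refine exists_bijOn_of_dual_families α (-κ) (fun i => toSphere n ⟨Q (S i), hmem (S i)⟩)
    (fun i => toSphere n ⟨star (v i), hu i⟩) (fun i => toSphere n ⟨v i, hv i⟩) ?_ ?_ ?_ ?_ ?_ ?_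
  · intro i ζ
    rw [hα, ← map_mul]
    congr 1
    refine Subtype.ext ?_
    have h := congrArg star (hgrade ζ i)
    simp only [star_mul, star_star, ← algebraMap_star_comm] at h
    simp only [mul_assoc, MulMemClass.mk_mul_mk] at h ⊢
    rw [h, ← Algebra.commutes]
    congr 2
    rw [zpow_neg, zpow_natCast, ← inv_pow, ← Circle.coe_inv, Circle.coe_inv_eq_conj, ← map_pow]
    rfl
  · intro i ζ
    rw [hα, ← map_mul]
    congr 1
    refine Subtype.ext ?_
    simp only [hgrade, neg_neg, zpow_natCast, MulMemClass.mk_mul_mk]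
  · intro i
    rw [← map_mul]
    congr 1
    refine Subtype.ext (clm_ext_delta fun z => ?_)
    change v i (Q (S i) (delta z)) = v i (delta z)
    rw [hQ]
    split_ifs with h
    · rfl
    · rw [map_zero, hvdef, hvd, if_neg h]
  · intro i
    rw [← map_mul]
    congr 1
    refine Subtype.ext (clm_ext_delta fun z => ?_)
    change star (v i) (v i (delta z)) = Q (S i) (delta z)
    rw [hQ]
    simp only [hvdef, hvd]
    split_ifs with h
    · rw [hud, if_pos (add_mem_orthantTranslate h), add_tsub_cancel_right]
    · rw [map_zero]
  · intro i j hij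
    rw [← map_mul, ← map_zero (toSphere n)]
    congr 1
    refine Subtype.ext (clm_ext_delta fun z => ?_)
    change star (v i) (v j (delta z)) = 0
    simp only [hvdef, hvd]
    split_ifs with h
    · have hj := add_mem_orthantTranslate (e := e j) h
      rw [hud, if_neg fun hi => hij ((hpart _ (hle j _ hj)).unique hi hj)]
    · rw [map_zero]
  · simp only [← map_mul]
    rw [← map_sum, ← map_one (toSphere n), toSphere_eq_iff]
    have hfin : {z : Fin n → ℕ | ∑ j, z j < κ}.Finite :=
      (Set.finite_Iic (fun _ : Fin n => κ)).subset fun z hz j =>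
        (Finset.single_le_sum (fun _ _ => Nat.zero_le _) (Finset.mem_univ j)).trans hz.le
    refine isCompactOperator_of_finite_support _ hfin.toFinset fun z hz => ?_
    have hz' : κ ≤ ∑ j, z j := by simpa using hz
    obtain ⟨i, hi, hi'⟩ := hpart z hz'
    have hvu : ∀ j, v j (star (v j) (delta z)) = if j = i then delta z else 0 := fun j => by
      simp only [hvdef, hud]
      by_cases hj : j = i
      · subst hj
        have h0 : ∀ l ∉ S j, (z - e j) l = 0 := fun l hl => by simp [hi.2 l hl]
        rw [if_pos hi, hvd, if_pos h0, if_pos rfl, tsub_add_cancel_of_le hi.1]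
      · rw [if_neg fun h => hj (hi' j h), if_neg hj, map_zero]
    simp [hvu]

/-- The vectors of `ℕ^n` of length at most `m` whose first `a` coordinates vanish. -/
abbrev TailVector (n a m : ℕ) : Type :=
  {w : Fin n → ℕ // (∀ j : Fin n, (j : ℕ) < a → w j = 0) ∧ ∑ j, w j ≤ m}

lemma nonempty_equiv_tailVector (n l : ℕ) : ∀ a m : ℕ, a + l = n →
    Nonempty (Fin (nu m (l + 1)) ≃ TailVector n a m) := by
  induction l with
  | zero =>
    intro a m hal
    have : Unique (TailVector n a m) :=
      { default := ⟨0, fun _ _ => rfl, by simp⟩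
        uniq := fun w => Subtype.ext (funext fun j => w.2.1 j (by omega)) }
    exact ⟨(finCongr (by simp [nu])).trans (Equiv.ofUnique (Fin 1) _)⟩
  | succ l ih =>
    intro a m hal
    have E := fun s : Fin (m + 1) => (ih (a + 1) s (by omega)).some
    let p : Fin n := ⟨a, by omega⟩
    let f : (Σ s : Fin (m + 1), TailVector n (a + 1) s) → TailVector n a m := fun x =>
      ⟨x.2.1 + Pi.single p (m - x.1), fun j hj => by
        have hjp : j ≠ p := fun h => by simp [h, p] at hj
        simp [hjp, x.2.2.1 j (by omega)], by
        have h1 := x.2.2.2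
        have h2 := x.1.2
        simp only [Pi.add_apply, Finset.sum_add_distrib, Finset.sum_pi_single', Finset.mem_univ,
          if_true]
        omega⟩
    have hf : Function.Bijective f := by
      constructor
      · rintro ⟨s, w⟩ ⟨s', w'⟩ h
        have h := congrArg Subtype.val h
        have hp := congrFun h p
        simp only [f, Pi.add_apply, Pi.single_eq_same, w.2.1 p (Nat.lt_succ_self a),
          w'.2.1 p (Nat.lt_succ_self a), zero_add] at hp
        obtain rfl : s = s' := Fin.ext (by omega)
        obtain rfl : w = w' := Subtype.ext (add_right_cancel h)
        rfl
      · intro w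
        have hwp : w.1 p ≤ ∑ j, w.1 j :=
          Finset.single_le_sum (fun _ _ => Nat.zero_le _) (Finset.mem_univ p)
        have hsum := w.2.2
        refine ⟨⟨⟨m - w.1 p, by omega⟩, ⟨Function.update w.1 p 0, fun j hj => ?_, ?_⟩⟩, ?_⟩
        · by_cases hjp : j = p
          · simp [hjp]
          · have : (j : ℕ) ≠ a := fun h => hjp (Fin.ext h)
            simp [hjp, w.2.1 j (by omega)]
        · have h := Finset.add_sum_erase Finset.univ w.1 (Finset.mem_univ p)
          rw [Finset.sum_update_of_mem (Finset.mem_univ p), ← Finset.erase_eq]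
          simp only [zero_add]
          omega
        · refine Subtype.ext (funext fun j => ?_)
          by_cases hjp : j = p
          · subst hjp
            simp only [f, Pi.add_apply, Function.update_self, Pi.single_eq_same]
            omega
          · simp [f, hjp]
    have hnu : nu m (l + 1 + 1) = ∑ s : Fin (m + 1), nu s (l + 1) := by
      rw [nu, Finset.sum_range]
    exact ⟨(finCongr hnu).trans (finSigmaFinEquiv.symm.trans
      ((Equiv.sigmaCongrRight E).trans (Equiv.ofBijective f hf)))⟩

lemma nu_add_two (m l : ℕ) : nu m (l + 2) = ∑ s ∈ Finset.range (m + 1), nu s (l + 1) := by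
  rw [nu]

lemma sum_mul_nu (κ l : ℕ) :
    ∑ m ∈ Finset.range (κ + 1), (κ + 1 - m) * nu m (l + 1) = nu κ (l + 3) := by
  induction κ with
  | zero => simp [nu]
  | succ κ ih =>
    have h : ∀ m ∈ Finset.range (κ + 1),
        (κ + 1 + 1 - m) * nu m (l + 1) = (κ + 1 - m) * nu m (l + 1) + nu m (l + 1) := by
      intro m hm
      rw [Nat.sub_add_comm (by simpa using (Finset.mem_range.1 hm).le), add_mul, one_mul]
    rw [Finset.sum_range_succ, Finset.sum_congr rfl h, Finset.sum_add_distrib, ih,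
      nu_add_two (κ + 1) (l + 1), Finset.sum_range_succ _ (κ + 1), ← nu_add_two κ (l + 1),
      nu_add_two (κ + 1) l, Finset.sum_range_succ _ (κ + 1), Nat.add_sub_cancel_left, one_mul,
      add_assoc]

/-- The translation vector of length `κ` obtained from a tail vector by filling coordinate `p`. -/
def fillVector {n : ℕ} (κ : ℕ) (x : Σ p : Fin n, TailVector n (p + 1) (κ - 1)) : Fin n → ℕ :=
  x.2.1 + Pi.single x.1 (κ - ∑ j, x.2.1 j)

lemma sum_fillVector {n κ : ℕ} (x : Σ p : Fin n, TailVector n (p + 1) (κ - 1)) :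
    ∑ j, fillVector κ x j = κ := by
  have := x.2.2.2
  simp only [fillVector, Pi.add_apply, Finset.sum_add_distrib, Finset.sum_pi_single',
    Finset.mem_univ, if_true]
  omega

lemma fillVector_of_lt {n κ : ℕ} (x : Σ p : Fin n, TailVector n (p + 1) (κ - 1)) {j : Fin n}
    (hj : j < x.1) : fillVector κ x j = 0 := by
  simp [fillVector, hj.ne, x.2.2.1 j (by have : (j : ℕ) < x.1 := hj; omega)]

lemma fillVector_of_gt {n κ : ℕ} (x : Σ p : Fin n, TailVector n (p + 1) (κ - 1)) {j : Fin n}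
    (hj : x.1 < j) : fillVector κ x j = x.2.1 j := by
  simp [fillVector, hj.ne']

/-- The region `{z : κ ≤ |z|}` is partitioned by the orthants attached to tail vectors: the pivot
of `z` is the last coordinate from which on the remaining length is at least `κ`. -/
lemma existsUnique_mem_orthantTranslate {n κ : ℕ} (hκ : 0 < κ) (z : Fin n → ℕ)
    (hz : κ ≤ ∑ j, z j) :
    ∃! x : Σ p : Fin n, TailVector n (p + 1) (κ - 1),
      z ∈ orthantTranslate (Finset.univ.filter fun i => i ≤ x.1) (fillVector κ x) := by
  have hgt : ∀ x : Σ p : Fin n, TailVector n (p + 1) (κ - 1),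
      z ∈ orthantTranslate (Finset.univ.filter fun i => i ≤ x.1) (fillVector κ x) →
      ∀ j, x.1 < j → x.2.1 j = z j := fun x hx j hj => by
    rw [hx.2 j (by simpa using hj), fillVector_of_gt x hj]
  have hnot : ∀ x y : Σ p : Fin n, TailVector n (p + 1) (κ - 1),
      z ∈ orthantTranslate (Finset.univ.filter fun i => i ≤ x.1) (fillVector κ x) →
      z ∈ orthantTranslate (Finset.univ.filter fun i => i ≤ y.1) (fillVector κ y) →
      ¬ x.1 < y.1 := fun x y hx hy hlt => by
    have hle : ∑ j, fillVector κ y j ≤ ∑ j, x.2.1 j := Finset.sum_le_sum fun j _ => by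
      rcases lt_or_ge j y.1 with hj | hj
      · simp [fillVector_of_lt y hj]
      · rw [hgt x hx j (hlt.trans_le hj)]
        exact hy.1 j
    rw [sum_fillVector] at hle
    have := x.2.2.2
    omega
  let G : ℕ → ℕ := fun i => ∑ j : Fin n, if i ≤ (j : ℕ) then z j else 0
  have hGn : G n < κ := by
    have : G n = 0 := Finset.sum_eq_zero fun j _ => if_neg (by omega)
    omega
  have hex : ∃ i, G i < κ := ⟨n, hGn⟩
  obtain ⟨a, ha⟩ : ∃ a, Nat.find hex = a + 1 := by
    refine Nat.exists_eq_succ_of_ne_zero fun h => ?_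
    have h0 := Nat.find_spec hex
    rw [h] at h0
    simp only [G, Nat.zero_le, if_true] at h0
    omega
  have han : a < n := by
    have := Nat.find_le (h := hex) hGn
    omega
  have hGs : G (a + 1) < κ := ha ▸ Nat.find_spec hex
  have hGa : κ ≤ G a := not_lt.1 (Nat.find_min hex (by omega))
  let p : Fin n := ⟨a, han⟩
  have hG : G a = G (a + 1) + z p := by
    have : z p = ∑ j : Fin n, if j = p then z j else 0 := by simp
    rw [this, ← Finset.sum_add_distrib]
    refine Finset.sum_congr rfl fun j _ => ?_
    simp only [p, Fin.ext_iff]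
    split_ifs <;> omega
  let w : TailVector n (p + 1) (κ - 1) := ⟨fun j => if a + 1 ≤ (j : ℕ) then z j else 0,
    fun j hj => if_neg (by simp only [p] at hj; omega), by
      change G (a + 1) ≤ κ - 1
      omega⟩
  have hw : z ∈ orthantTranslate (Finset.univ.filter fun i => i ≤ p) (fillVector κ ⟨p, w⟩) := by
    refine ⟨fun j => ?_, fun j hj => ?_⟩
    · rcases lt_trichotomy j p with hj | hj | hj
      · rw [fillVector_of_lt ⟨p, w⟩ hj]
        exact Nat.zero_le _
      · have h0 : w.1 p = 0 := w.2.1 p (Nat.lt_succ_self _)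
        have h1 : ∑ j, w.1 j = G (a + 1) := rfl
        subst hj
        simp only [fillVector, Pi.add_apply, Pi.single_eq_same, h0, h1]
        omega
      · rw [fillVector_of_gt ⟨p, w⟩ hj]
        exact (if_pos (show a + 1 ≤ (j : ℕ) from hj)).le
    · have hj : p < j := by simpa using hj
      rw [fillVector_of_gt ⟨p, w⟩ hj]
      exact (if_pos (show a + 1 ≤ (j : ℕ) from hj)).symm
  refine ⟨⟨p, w⟩, hw, ?_⟩
  rintro ⟨p', w'⟩ hw'
  obtain rfl : p' = p := le_antisymm (not_lt.1 (hnot _ _ hw hw')) (not_lt.1 (hnot _ _ hw' hw))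
  obtain rfl : w' = w := by
    refine Subtype.ext (funext fun j => ?_)
    rcases le_or_gt j p with hj | hj
    · rw [w.2.1 j (Nat.lt_succ_of_le hj), w'.2.1 j (Nat.lt_succ_of_le hj)]
    · exact (hgt _ hw' j hj).trans (hgt _ hw j hj).symm
  rfl

lemma bijective_sumElim_sigma_rev {N : ℕ} (X : Fin (N + 1) → Type*) :
    Function.Bijective (Sum.elim (fun x => ⟨0, x⟩) (fun y => ⟨y.1.rev.succ, y.2⟩) :
      X 0 ⊕ (Σ l : Fin N, X l.rev.succ) → Σ p, X p) := by
  constructor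
  · rintro (x | ⟨l, x⟩) (y | ⟨l', y⟩) h
    · simpa using h
    · exact ((Fin.succ_ne_zero l'.rev).symm (congrArg Sigma.fst h)).elim
    · exact (Fin.succ_ne_zero l.rev (congrArg Sigma.fst h)).elim
    · obtain rfl : l = l' := Fin.rev_injective (Fin.succ_injective _ (congrArg Sigma.fst h))
      simpa using h
  · rintro ⟨p, x⟩
    rcases Fin.eq_zero_or_eq_succ p with rfl | ⟨q, rfl⟩
    · exact ⟨Sum.inl x, rfl⟩
    · obtain ⟨l, rfl⟩ := Fin.rev_surjective q
      exact ⟨Sum.inr ⟨l, x⟩, rfl⟩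

lemma exists_equiv_sigma_tailVector (N m c : ℕ) (hc : c = nu m (N + 1)) :
    ∃ D : (Fin c ⊕ Σ l : Fin N, Fin (nu m (l.1 + 1))) ≃
        Σ p : Fin (N + 1), TailVector (N + 1) (p + 1) m,
      (∀ i, (D (Sum.inl i)).1 = 0) ∧ ∀ y, (D (Sum.inr y)).1 = y.1.rev.succ := by
  subst hc
  obtain ⟨E₀⟩ := nonempty_equiv_tailVector (N + 1) N ((0 : Fin (N + 1)) + 1) m (by simp; omega)
  have E := fun l : Fin N =>
    (nonempty_equiv_tailVector (N + 1) l (l.rev.succ + 1) m (by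
      simp only [Fin.val_succ, Fin.val_rev]
      omega)).some
  exact ⟨(Equiv.sumCongr E₀ (Equiv.sigmaCongrRight E)).trans
    (Equiv.ofBijective _ (bijective_sumElim_sigma_rev
      fun p : Fin (N + 1) => TailVector (N + 1) (p + 1) m)), fun _ => rfl, fun _ => rfl⟩

theorem stmt11 (n : ℕ) (hn : 2 < n) (k : ℤ) (hk : k < 0)
    (Q : Finset (Fin n) → (Hn n →L[ℂ] Hn n))
    (hQ : ∀ S, IsQProj S (Q S)) (hmem : ∀ S, Q S ∈ Toeplitz n)
    (V : Circle → (Hn n →L[ℂ] Hn n))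
    (hV : ∀ (ζ : Circle) (z : Fin n → ℕ),
      V ζ (delta z) = ((ζ : ℂ) ^ (∑ i, z i)) • delta z)
    (hconj : ∀ (ζ : Circle) (T : Hn n →L[ℂ] Hn n), T ∈ Toeplitz n →
      V ζ * T * star (V ζ) ∈ Toeplitz n)
    (α : Circle → (QuantumSphere n →+* QuantumSphere n))
    (hα : ∀ (ζ : Circle) (T : Hn n →L[ℂ] Hn n) (hT : T ∈ Toeplitz n),
      α ζ (toSphere n ⟨T, hT⟩) = toSphere n ⟨V ζ * T * star (V ζ), hconj ζ T hT⟩)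
    -- the multiplicity `c` of the summand `B_n ∂(Q_{S₁})`
    (c : ℕ) (hc : c = ∑ m ∈ Finset.range k.natAbs, (k.natAbs - m) * nu m (n - 2))
    -- `S₁ = {0} ⊆ Fin n`
    (S₁ : Finset (Fin n)) (hS₁ : S₁ = {(⟨0, by omega⟩ : Fin n)})
    -- `T_l = {0, 1, …, n - l} ⊆ Fin n`
    (Tl : ℕ → Finset (Fin n))
    (hTl : ∀ l, Tl l = Finset.univ.filter fun i : Fin n => (i : ℕ) ≤ n - l) :
    -- `L_k` is isomorphic, as a left `B_n`-module, to the direct sum of `c` copies of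
    -- `B_n ∂(Q_{S₁})` and, for each `1 ≤ l ≤ n - 1`, `ν(|k|-1, l)` copies of `B_n ∂(Q_{T_l})`
    ∃ F : QuantumSphere n →
        ((Fin c ⊕ (Σ l : Fin (n - 1), Fin (nu (k.natAbs - 1) (l.1 + 1)))) → QuantumSphere n),
      Set.BijOn F (lineBundle α k)
        {g | ∀ i, g i ∈
          Sum.elim (fun _ : Fin c => BnMul α (toSphere n ⟨Q S₁, hmem S₁⟩))
            (fun p : Σ l : Fin (n - 1), Fin (nu (k.natAbs - 1) (l.1 + 1)) =>
              BnMul α (toSphere n ⟨Q (Tl (p.1.1 + 1)), hmem (Tl (p.1.1 + 1))⟩)) i} ∧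
      (∀ x ∈ lineBundle α k, ∀ y ∈ lineBundle α k, F (x + y) = F x + F y) ∧
      (∀ b ∈ fixedSubring α, ∀ x ∈ lineBundle α k, F (b * x) = fun i => b * F x i) := by
  obtain ⟨N, rfl⟩ : ∃ N, n = N + 3 := ⟨n - 3, by omega⟩
  have hκ : 0 < k.natAbs := by omega
  have hkκ : k = -(k.natAbs : ℤ) := by omega
  generalize k.natAbs = κ at *
  subst hkκ
  obtain ⟨D, hD₀, hD⟩ := exists_equiv_sigma_tailVector (N + 2) (κ - 1) c
    (by
      obtain ⟨κ, rfl⟩ := Nat.exists_eq_add_one.2 hκ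
      exact hc.trans (sum_mul_nu κ N))
  obtain ⟨F, hF, hadd, hmul⟩ := exists_bijOn_of_partition κ Q hQ hmem V hV hconj α hα
    (fun i => Finset.univ.filter fun j => j ≤ (D i).1) (fun i => fillVector κ (D i))
    (fun i => sum_fillVector (D i)) fun z hz => by
      obtain ⟨x, hx, hx'⟩ := existsUnique_mem_orthantTranslate hκ z hz
      exact ⟨D.symm x, by simpa using hx, fun y hy => D.eq_symm_apply.2 (hx' _ hy)⟩
  refine ⟨F, ?_, hadd, hmul⟩
  refine Eq.mpr (congrArg (Set.BijOn F (lineBundle α (-κ)))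
    (Set.ext fun g => forall_congr' fun i => ?_)) hF
  rcases i with i | y
  · have : S₁ = Finset.univ.filter fun j => j ≤ (D (Sum.inl i)).1 := by
      ext j
      simp [hS₁, hD₀]
    simp only [Sum.elim_inl, this]
  · have : Tl (y.1.1 + 1) = Finset.univ.filter fun j => j ≤ (D (Sum.inr y)).1 := by
      ext j
      simp only [hTl, hD, Finset.mem_filter, Finset.mem_univ, true_and, Fin.le_def, Fin.val_succ,
        Fin.val_rev]
      omega
    simp only [Sum.elim_inr, this]
end
end

section
/- Let n ≥ 1, let S ⊆ Fin n with |S| = j, and set A_S := {z ∈ (ℕ∞)^n : z_i = ∞ if and only if i ∈ S} and X_j := {z ∈ (ℕ∞)^n : exactly j coordinates of z equal ∞}. Then A_S is both open and closed in the subspace X_j of (ℕ∞)^n, and the subspace topology that A_S inherits from (ℕ∞)^n is discrete. -/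
open scoped ENat

/-- If `z` has exactly `S.card` infinite coordinates, then its infinite coordinates are those in
`S` as soon as they all lie in `S`. -/
theorem forall_eq_top_iff_mem_iff_forall_notMem {ι : Type*} [Fintype ι] {S : Finset ι} {z : ι → ℕ∞}
    (hz : (Finset.univ.filter fun i => z i = ⊤).card = S.card) :
    (∀ i, z i = ⊤ ↔ i ∈ S) ↔ ∀ i, i ∉ S → z i ≠ ⊤ := by
  refine ⟨fun h i hi => mt (h i).1 hi, fun h i => ?_⟩
  have heq : (Finset.univ.filter fun i => z i = ⊤) = S :=
    Finset.eq_of_subset_of_card_le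
      (fun i hi => by_contra fun hiS => h i hiS (Finset.mem_filter.1 hi).2) hz.ge
  simp [← heq]

/-- If `z` has exactly `S.card` infinite coordinates, then its infinite coordinates are those in
`S` as soon as every coordinate in `S` is infinite. -/
theorem forall_eq_top_iff_mem_iff_forall_mem {ι : Type*} [Fintype ι] {S : Finset ι} {z : ι → ℕ∞}
    (hz : (Finset.univ.filter fun i => z i = ⊤).card = S.card) :
    (∀ i, z i = ⊤ ↔ i ∈ S) ↔ ∀ i, i ∈ S → z i = ⊤ := by
  refine ⟨fun h i hi => (h i).2 hi, fun h i => ?_⟩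
  have heq : S = Finset.univ.filter fun i => z i = ⊤ :=
    Finset.eq_of_subset_of_card_le
      (fun i hi => Finset.mem_filter.2 ⟨Finset.mem_univ i, h i hi⟩) hz.le
  simp [heq]

/-- The points of `ι → ℕ∞` whose set of infinite coordinates is `S` form a discrete subspace. -/
theorem discreteTopology_forall_eq_top_iff_mem {ι : Type*} [Finite ι] (S : Finset ι) :
    DiscreteTopology {z : ι → ℕ∞ // ∀ i, z i = ⊤ ↔ i ∈ S} := by
  refine discreteTopology_iff_isOpen_singleton.2 fun z => ?_
  have heq : ({z} : Set {z : ι → ℕ∞ // ∀ i, z i = ⊤ ↔ i ∈ S}) =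
      ⋂ i, ⋂ _ : i ∉ S, {w | w.1 i = z.1 i} := by
    ext w
    simp only [Set.mem_singleton_iff, Set.mem_iInter, Set.mem_ofPred_eq]
    refine ⟨fun h i _ => by rw [h], fun h => Subtype.ext (funext fun i => ?_)⟩
    by_cases hi : i ∈ S
    · rw [(w.2 i).2 hi, (z.2 i).2 hi]
    · exact h i hi
  rw [heq]
  refine isOpen_iInter_of_finite fun i => isOpen_iInter_of_finite fun hi => ?_
  have hcont : Continuous fun w : {z : ι → ℕ∞ // ∀ i, z i = ⊤ ↔ i ∈ S} => w.1 i :=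
    (continuous_apply i).comp continuous_subtype_val
  exact (ENat.isOpen_singleton (mt (z.2 i).1 hi)).preimage hcont

theorem stmt15 (n j : ℕ) (hn : 1 ≤ n) (S : Finset (Fin n)) (hS : S.card = j) :
    -- `A_S` is open in the subspace `X_j`
    IsOpen {z : {w : Fin n → ℕ∞ //
        (Finset.univ.filter fun i : Fin n => w i = ⊤).card = j} |
      ∀ i : Fin n, z.1 i = ⊤ ↔ i ∈ S} ∧
    -- `A_S` is closed in the subspace `X_j`
    IsClosed {z : {w : Fin n → ℕ∞ //
        (Finset.univ.filter fun i : Fin n => w i = ⊤).card = j} |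
      ∀ i : Fin n, z.1 i = ⊤ ↔ i ∈ S} ∧
    -- the subspace topology `A_S` inherits from `(ℕ∞)^n` is discrete
    DiscreteTopology {z : Fin n → ℕ∞ // ∀ i : Fin n, z i = ⊤ ↔ i ∈ S} := by
  subst hS
  refine ⟨?_, ?_, discreteTopology_forall_eq_top_iff_mem S⟩
  · simp only [fun z : {w : Fin n → ℕ∞ //
      (Finset.univ.filter fun i : Fin n => w i = ⊤).card = S.card} =>
        forall_eq_top_iff_mem_iff_forall_notMem z.2, Set.ofPred_forall]
    refine isOpen_iInter_of_finite fun i => isOpen_iInter_of_finite fun _ => ?_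
    exact isOpen_ne.preimage ((continuous_apply i).comp continuous_subtype_val)
  · simp only [fun z : {w : Fin n → ℕ∞ //
      (Finset.univ.filter fun i : Fin n => w i = ⊤).card = S.card} =>
        forall_eq_top_iff_mem_iff_forall_mem z.2, Set.ofPred_forall]
    refine isClosed_iInter fun i => isClosed_iInter fun _ => ?_
    exact isClosed_singleton.preimage ((continuous_apply i).comp continuous_subtype_val)
end
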